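/- Let n > k ≥ 1, N ≥ 1 and T₁ ≥ N be integers. If a systematic (n; k) point-to-point single-link code achieves, under N erasures, a delay spectrum whose equally-delayed grouping has the consecutive delays T^(g)[j] = T₁ − (j−1) for j = 1,…,ℓg with counts k^(g)[1],…,k^(g)[ℓg], where ℓg = T₁ + 1 − N, then for every j ∈ {1,…,ℓg}: Σ_{ℓ′=j}^{ℓg} k^(g)[ℓ′] ≤ (T^(g)[j] + 1 − N)·(n−k)/N, as an inequality of rational numbers. -/

import Mathlib

open scoped BigOperators

/-- Output of an erasure link whose (finite) set of erased time slots is `E`: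
at time `t` the receiver obtains the channel packet `x t` if `t ∉ E`,
and the erasure symbol `*` (modelled by `none`) otherwise. -/
def linkOut {α : Type*} (E : Finset ℕ) (x : ℕ → α) (t : ℕ) : Option α :=
  if t ∈ E then none else some (x t)

/-- An `(n; k)` point-to-point single-link code over the alphabet `F`:
at each time `t`, an encoder maps the source packets `s₀, …, s_t ∈ F^k`
to a channel packet in `F^n`. -/
structure SLCode (F : Type) (n k : ℕ) where
  enc : (t : ℕ) → (Fin (t + 1) → (Fin k → F)) → (Fin n → F)

namespace SLCode

variable {F : Type} {n k : ℕ}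

/-- Channel packet transmitted at time `t` for the source sequence `s`. -/
def x (c : SLCode F n k) (s : ℕ → Fin k → F) (t : ℕ) : Fin n → F :=
  c.enc t (fun u => s u)

/-- The code achieves delay spectrum `T` under `N` erasures: there are decoders such
that, for every `N`-erasure sequence, every time `t` and every `j`, the symbol `s t j`
is computed exactly from the link outputs `{y t' : t' ≤ t + T j}`. -/
def Achieves (c : SLCode F n k) (N : ℕ) (T : Fin k → ℕ) : Prop :=
  ∃ dec : (t : ℕ) → (j : Fin k) → (Fin (t + T j + 1) → Option (Fin n → F)) → F,
    ∀ (s : ℕ → Fin k → F) (E : Finset ℕ), E.card = N →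
      ∀ (t : ℕ) (j : Fin k),
        dec t j (fun t' => linkOut E (fun u => c.x s u) t') = s t j

/-- The code is systematic: the first `k` symbols of each channel packet are the
corresponding source symbols. -/
def Systematic (c : SLCode F n k) (h : k ≤ n) : Prop :=
  ∀ (s : ℕ → Fin k → F) (t : ℕ) (j : Fin k), c.x s t (Fin.castLE h j) = s t j

end SLCode

namespace SLCode

variable {F : Type} {n k : ℕ}

/-- Channel packets up to time `t` depend only on the source packets up to time `t`. -/
theorem x_congr (c : SLCode F n k) {s s' : ℕ → Fin k → F} {t : ℕ}
    (h : ∀ u ≤ t, s u = s' u) : c.x s t = c.x s' t := by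
  unfold x
  congr 1
  funext u
  exact h u (Nat.lt_succ_iff.mp u.isLt)

/-- If two source sequences yield the same link outputs up to time `t + T j` under some
`N`-erasure sequence, then they agree at time `t` in the symbol `j`. -/
theorem Achieves.source_eq {c : SLCode F n k} {N : ℕ} {T : Fin k → ℕ} (hach : c.Achieves N T)
    {s s' : ℕ → Fin k → F} {E : Finset ℕ} (hE : E.card = N) {t : ℕ} {j : Fin k}
    (h : ∀ u ≤ t + T j, u ∉ E → c.x s u = c.x s' u) : s t j = s' t j := by
  obtain ⟨dec, hdec⟩ := hach
  rw [← hdec s E hE t j, ← hdec s' E hE t j]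
  congr 1
  funext u
  unfold linkOut
  split_ifs with hu
  · rfl
  · exact congrArg some (h u (Nat.lt_succ_iff.mp u.isLt) hu)

/-- Two source sequences that can differ only at times before `N` and in symbols of delay at
most `D`, and whose channel packets agree at the times `N, …, D`, are equal. -/
theorem Achieves.source_eq_of_window {c : SLCode F n k} {N D : ℕ} {T : Fin k → ℕ}
    (hach : c.Achieves N T) (hND : N ≤ D) {s s' : ℕ → Fin k → F}
    (hlate : ∀ t, N ≤ t → s t = s' t) (hslow : ∀ t j, D < T j → s t j = s' t j)
    (hx : ∀ t, N ≤ t → t ≤ D → c.x s t = c.x s' t) : s = s' := by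
  funext t
  induction t using Nat.strong_induction_on with
  | _ t ih =>
    rcases le_or_gt N t with ht | ht
    · exact hlate t ht
    funext j
    rcases lt_or_ge D (T j) with hj | hj
    · exact hslow t j hj
    have hcard : (Finset.Ico t N ∪ Finset.Ico (D + 1) (D + 1 + t)).card = N := by
      rw [Finset.card_union_of_disjoint, Nat.card_Ico, Nat.card_Ico]
      · omega
      · rw [Finset.disjoint_left]
        intro u hu hu'
        rw [Finset.mem_Ico] at hu hu'
        omega
    refine hach.source_eq hcard fun u hu huE => ?_
    simp only [Finset.mem_union, Finset.mem_Ico] at huE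
    rcases lt_or_ge u t with hut | hut
    · exact c.x_congr fun v hv => ih v (by omega)
    · exact hx u (by omega) (by omega)

/-- The source sequence carrying the array `a` in the symbols of delay at most `D` during the
first `N` time slots, and zero elsewhere. -/
def burst [Zero F] (N D : ℕ) (T : Fin k → ℕ) (a : Fin N × {i : Fin k // T i ≤ D} → F) :
    ℕ → Fin k → F :=
  fun t i => if h : t < N ∧ T i ≤ D then a (⟨t, h.1⟩, ⟨i, h.2⟩) else 0

/-- In a systematic code, `N` slots of symbols of delay at most `D` must be carried by the
parity symbols of the `D + 1 - N` slots that follow. -/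
theorem Achieves.card_mul_le [Zero F] [Fintype F] [Nontrivial F] {c : SLCode F n k} {N D : ℕ}
    {T : Fin k → ℕ} (hach : c.Achieves N T) (hkn : k ≤ n) (hsys : c.Systematic hkn)
    (hND : N ≤ D) :
    N * Fintype.card {i : Fin k // T i ≤ D} ≤ (D + 1 - N) * (n - k) := by
  classical
  let parity : (Fin N × {i : Fin k // T i ≤ D} → F) → (Fin (D + 1 - N) × Fin (n - k) → F) :=
    fun a p => c.x (burst N D T a) (N + p.1) ⟨k + p.2, by omega⟩
  have hinj : Function.Injective parity := by
    intro a b hab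
    have hs : burst N D T a = burst N D T b := by
      refine hach.source_eq_of_window hND (fun t ht => ?_) (fun t j hj => ?_)
        (fun t ht htD => ?_)
      · funext i
        simp [burst, ht.not_gt]
      · simp [burst, hj.not_ge]
      · funext i
        rcases lt_or_ge (i : ℕ) k with hi | hi
        · have ha := hsys (burst N D T a) t ⟨i, hi⟩
          have hb := hsys (burst N D T b) t ⟨i, hi⟩
          have hzero : burst N D T a t ⟨i, hi⟩ = burst N D T b t ⟨i, hi⟩ := by
            simp [burst, ht.not_gt]
          exact ha.trans (hzero.trans hb.symm)
        · have hp := congrFun hab (⟨t - N, by omega⟩, ⟨i - k, by omega⟩)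
          simpa [parity, Nat.add_sub_cancel' ht, Nat.add_sub_cancel' hi] using hp
    funext p
    have hp := congrFun (congrFun hs p.1) p.2
    simpa [burst, p.1.isLt, p.2.property] using hp
  have hcard := Fintype.card_le_of_injective parity hinj
  simp only [Fintype.card_fun, Fintype.card_prod, Fintype.card_fin] at hcard
  exact (Nat.pow_le_pow_iff_right Fintype.one_lt_card).mp hcard

end SLCode

/-- The groups from `j` on contain only symbols of delay at most `T₁ - j`. -/
theorem sum_card_delay_le {k N T₁ : ℕ} (T : Fin k → ℕ) (j : Fin (T₁ + 1 - N)) :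
    ∑ l ∈ Finset.Ici j, (Finset.univ.filter (fun i => T i = T₁ - (l : ℕ))).card ≤
      Fintype.card {i : Fin k // T i ≤ T₁ - (j : ℕ)} := by
  rw [← Finset.card_biUnion, Fintype.card_subtype]
  · refine Finset.card_le_card fun i hi => ?_
    simp only [Finset.mem_biUnion, Finset.mem_Ici, Finset.mem_filter, Finset.mem_univ,
      true_and] at hi ⊢
    obtain ⟨l, hl, hi⟩ := hi
    have : (j : ℕ) ≤ l := hl
    omega
  · intro l _ l' _ hne
    rw [Function.onFun, Finset.disjoint_left]
    intro i hi hi'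
    simp only [Finset.mem_filter, Finset.mem_univ, true_and] at hi hi'
    exact hne (Fin.ext (by omega))

/-- Let `n > k ≥ 1`, `N ≥ 1` and `T₁ ≥ N`.  If a systematic `(n; k)`
point-to-point single-link code achieves, under `N` erasures, a delay spectrum whose
equally-delayed grouping has consecutive delays `Tg j = T₁ − j` (zero-based) for
`j = 0, …, ℓg − 1` with `ℓg = T₁ + 1 − N` and counts `kg`, then for every group `j`,
`Σ_{l ≥ j} kg l ≤ (Tg j + 1 − N)·(n−k)/N` as rational numbers. -/
theorem stmt7 (F : Type) [Field F] [Fintype F] (n k N T₁ : ℕ)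
    (hk : 1 ≤ k) (hnk : k < n) (hN : 1 ≤ N) (hT₁ : N ≤ T₁)
    (T : Fin k → ℕ) (kg : Fin (T₁ + 1 - N) → ℕ)
    (hcount : ∀ j : Fin (T₁ + 1 - N),
      kg j = (Finset.univ.filter (fun i => T i = T₁ - (j : ℕ))).card)
    (hcover : ∀ i : Fin k, ∃ j : Fin (T₁ + 1 - N), T i = T₁ - (j : ℕ))
    (c : SLCode F n k) (hsys : c.Systematic (le_of_lt hnk)) (hach : c.Achieves N T) :
    ∀ j : Fin (T₁ + 1 - N),
      (∑ l ∈ Finset.Ici j, (kg l : ℚ)) ≤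
        (((T₁ - (j : ℕ) : ℕ) : ℚ) + 1 - N) * ((n : ℚ) - k) / N := by
  intro j
  have hbound := hach.card_mul_le (D := T₁ - j) hnk.le hsys (by omega)
  have hsum : ∑ l ∈ Finset.Ici j, kg l ≤ Fintype.card {i : Fin k // T i ≤ T₁ - (j : ℕ)} := by
    simpa only [hcount] using sum_card_delay_le T j
  have hmain := (Nat.mul_le_mul_left N hsum).trans hbound
  have hN' : (0 : ℚ) < N := by exact_mod_cast hN
  rw [le_div_iff₀ hN', mul_comm]
  have hcast : ((N * ∑ l ∈ Finset.Ici j, kg l : ℕ) : ℚ) ≤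
      (((T₁ - (j : ℕ) + 1 - N) * (n - k) : ℕ) : ℚ) := by exact_mod_cast hmain
  rw [Nat.cast_mul, Nat.cast_sum, Nat.cast_mul, Nat.cast_sub hnk.le,
    Nat.cast_sub (show N ≤ T₁ - (j : ℕ) + 1 by omega), Nat.cast_add_one] at hcast
  exact hcast
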